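/- arXiv:1104.4680 — 2 statements merged into one kernel-verified Lean document; each statement's English description precedes it below -/
import Mathlib

section
/- There exist absolute constants c₁, c₂ > 0 such that the following holds. Let G be a regular weighted graph on vertex set V = [n] with normalized adjacency matrix A (symmetric and doubly stochastic), and let X₁, …, Xₙ be jointly distributed random variables with values in [k] = {1, …, k} on a finite probability space with Var X_{ia} > 0 for all i ∈ V, a ∈ [k]. Let ε := E_{ij∼G} ‖{(X_i, X_j)} − {X_i}⊗{X_j}‖₁ be the expected ℓ¹-distance between correlated and independent sampling across the edges of G. Then E_{i,j∈V} E_{{X_j}} Var[X_i | X_j] ≤ E_{i∈V} Var X_i − c₁·ε² / (k · rank_{≥ c₂·ε²/k²}(G)). -/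
open Finset

noncomputable section

variable {Ω : Type*} [Fintype Ω]

/-- Expectation of a real random variable `f` under the weight function `p`. -/
def pExp (p : Ω → ℝ) (f : Ω → ℝ) : ℝ := ∑ ω, p ω * f ω

/-- Probability of the event `E` under the weight function `p`. -/
def pProb (p : Ω → ℝ) (E : Ω → Prop) [DecidablePred E] : ℝ := ∑ ω, if E ω then p ω else 0

/-- Variance of a real random variable under `p`. -/
def pVar (p : Ω → ℝ) (f : Ω → ℝ) : ℝ := pExp p (fun ω => (f ω - pExp p f) ^ 2)

/-- The measure `p` conditioned on the event `E`. -/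
def pCond (p : Ω → ℝ) (E : Ω → Prop) [DecidablePred E] : Ω → ℝ :=
  fun ω => if E ω then p ω / pProb p E else 0

/-- The `{0,1}`-indicator of the event `X = a`. -/
def pInd {k : ℕ} (X : Ω → Fin k) (a : Fin k) : Ω → ℝ := fun ω => if X ω = a then 1 else 0

/-- The variance of a `[k]`-valued random variable, `Var X = Σ_a Var X_a`. -/
def pVarK (p : Ω → ℝ) {k : ℕ} (X : Ω → Fin k) : ℝ := ∑ a, pVar p (pInd X a)

/-- `E_{{Y}} Var[f | Y]`: the expectation over the distribution of `Y` of the variance of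
the real random variable `f` conditioned on the value of `Y`. -/
def pCondVar (p : Ω → ℝ) (f : Ω → ℝ) {β : Type*} [DecidableEq β] (Y : Ω → β) : ℝ :=
  ∑ y ∈ Finset.univ.image Y,
    if 0 < pProb p (fun ω => Y ω = y)
    then pProb p (fun ω => Y ω = y) * pVar (pCond p (fun ω => Y ω = y)) f
    else 0

/-- `E_{{Y}} Var[X | Y]` for a `[k]`-valued random variable `X`, where
`Var X = Σ_a Var X_a`. -/
def pCondVarK (p : Ω → ℝ) {k : ℕ} (X : Ω → Fin k) {β : Type*} [DecidableEq β] (Y : Ω → β) : ℝ :=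
  ∑ a, pCondVar p (pInd X a) Y

/-- The number of eigenvalues of a Hermitian (symmetric real) matrix that are
at least `τ`, counted with multiplicity. -/
def rankGe {n : ℕ} {A : Matrix (Fin n) (Fin n) ℝ} (hA : A.IsHermitian) (τ : ℝ) : ℕ :=
  (Finset.univ.filter (fun r => τ ≤ hA.eigenvalues r)).card

lemma quad_eig {n : ℕ} {A : Matrix (Fin n) (Fin n) ℝ} (hA : A.IsHermitian) (y : Fin n → ℝ) :
    ∑ i, ∑ j, A i j * y i * y j = ∑ r, hA.eigenvalues r * (∑ i, hA.eigenvectorBasis r i * y i) ^ 2 := by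
  have h : ∀ i j, A i j = ∑ r, hA.eigenvalues r * (hA.eigenvectorBasis r i * hA.eigenvectorBasis r j) := by
    intro i j
    have := congrFun (congrFun hA.spectral_theorem i) j
    rw [this]
    simp [Matrix.mul_apply, Unitary.conjStarAlgAut_apply, Matrix.diagonal_apply, Matrix.star_apply]
    exact Finset.sum_congr rfl fun r _ => by ring
  simp_rw [h, sq, Finset.sum_mul_sum, Finset.mul_sum, Finset.sum_mul]
  rw [Finset.sum_comm_cycle]
  refine Finset.sum_congr rfl fun r _ => ?_
  refine Finset.sum_congr rfl fun i _ => Finset.sum_congr rfl fun j _ => ?_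
  ring

lemma norm_eig {n : ℕ} {A : Matrix (Fin n) (Fin n) ℝ} (hA : A.IsHermitian) (y : Fin n → ℝ) :
    ∑ i, y i ^ 2 = ∑ r, (∑ i, hA.eigenvectorBasis r i * y i) ^ 2 := by
  have := hA.eigenvectorBasis.sum_sq_norm_inner_right (WithLp.toLp 2 y)
  rw [EuclideanSpace.real_norm_sq_eq] at this
  simp [PiLp.inner_apply] at this
  rw [← this]
  refine Finset.sum_congr rfl fun r _ => ?_
  congr 1
  exact Finset.sum_congr rfl fun i _ => by ring

lemma eig_sq_sum {n : ℕ} {A : Matrix (Fin n) (Fin n) ℝ} (hA : A.IsHermitian) (r : Fin n) :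
    ∑ i, hA.eigenvectorBasis r i ^ 2 = 1 := by
  have := hA.eigenvectorBasis.orthonormal.1 r
  have h2 := EuclideanSpace.real_norm_sq_eq (hA.eigenvectorBasis r)
  rw [this] at h2
  simpa using h2.symm

lemma quad_le {n : ℕ} {A : Matrix (Fin n) (Fin n) ℝ} (hA : A.IsHermitian)
    (h0 : ∀ i j, 0 ≤ A i j) (h1 : ∀ i, ∑ j, A i j = 1) (y : Fin n → ℝ) :
    ∑ i, ∑ j, A i j * y i * y j ≤ ∑ i, y i ^ 2 := by
  have hs : ∀ i j, A i j = A j i := fun i j => by simpa using (hA.apply i j).symm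
  have e1 : ∑ i, ∑ j, A i j * y i ^ 2 = ∑ i, y i ^ 2 := by
    refine Finset.sum_congr rfl fun i _ => ?_
    rw [← Finset.sum_mul, h1, one_mul]
  have e2 : ∑ i, ∑ j, A i j * y j ^ 2 = ∑ i, y i ^ 2 := by
    rw [Finset.sum_comm, ← e1]
    exact Finset.sum_congr rfl fun i _ => Finset.sum_congr rfl fun j _ => by rw [hs]
  have : 2 * ∑ i, ∑ j, A i j * y i * y j ≤ ∑ i, ∑ j, A i j * y i ^ 2 + ∑ i, ∑ j, A i j * y j ^ 2 := by
    rw [Finset.mul_sum, ← Finset.sum_add_distrib]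
    refine Finset.sum_le_sum fun i _ => ?_
    rw [Finset.mul_sum, ← Finset.sum_add_distrib]
    refine Finset.sum_le_sum fun j _ => ?_
    nlinarith [mul_nonneg (h0 i j) (sq_nonneg (y i - y j))]
  linarith

lemma eig_le_one {n : ℕ} {A : Matrix (Fin n) (Fin n) ℝ} (hA : A.IsHermitian)
    (h0 : ∀ i j, 0 ≤ A i j) (h1 : ∀ i, ∑ j, A i j = 1) (r : Fin n) : hA.eigenvalues r ≤ 1 := by
  have h := quad_le hA h0 h1 (fun i => hA.eigenvectorBasis r i)
  have hm := hA.mulVec_eigenvectorBasis r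
  have hs := eig_sq_sum hA r
  have : ∑ i, ∑ j, A i j * hA.eigenvectorBasis r i * hA.eigenvectorBasis r j
      = ∑ i, hA.eigenvalues r * hA.eigenvectorBasis r i ^ 2 := by
    refine Finset.sum_congr rfl fun i _ => ?_
    have := congrFun hm i
    simp [Matrix.mulVec, dotProduct] at this
    rw [sq, ← mul_assoc, ← this, Finset.sum_mul]
    exact Finset.sum_congr rfl fun j _ => by ring
  rw [this, ← Finset.mul_sum, hs] at h
  linarith

/-- projection onto the eigenvectors of eigenvalue at least `τ` -/
def Pm {n : ℕ} {A : Matrix (Fin n) (Fin n) ℝ} (hA : A.IsHermitian) (τ : ℝ) (i j : Fin n) : ℝ :=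
  ∑ r ∈ Finset.univ.filter (fun r => τ ≤ hA.eigenvalues r),
    hA.eigenvectorBasis r i * hA.eigenvectorBasis r j

lemma Pm_trace {n : ℕ} {A : Matrix (Fin n) (Fin n) ℝ} (hA : A.IsHermitian) (τ : ℝ) :
    ∑ i, Pm hA τ i i = rankGe hA τ := by
  unfold Pm rankGe
  rw [Finset.sum_comm]
  simp_rw [← sq, eig_sq_sum]
  simp

lemma Pm_nonneg {n : ℕ} {A : Matrix (Fin n) (Fin n) ℝ} (hA : A.IsHermitian) (τ : ℝ) (i) :
    0 ≤ Pm hA τ i i := Finset.sum_nonneg fun r _ => mul_self_nonneg _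

lemma Pm_cs {n : ℕ} {A : Matrix (Fin n) (Fin n) ℝ} (hA : A.IsHermitian) (τ : ℝ) (i j) :
    Pm hA τ i j ^ 2 ≤ Pm hA τ i i * Pm hA τ j j := by
  unfold Pm
  have := Finset.sum_mul_sq_le_sq_mul_sq (Finset.univ.filter (fun r => τ ≤ hA.eigenvalues r))
    (fun r => hA.eigenvectorBasis r i) (fun r => hA.eigenvectorBasis r j)
  simpa only [sq] using this

lemma quad_trunc {n : ℕ} {A : Matrix (Fin n) (Fin n) ℝ} (hA : A.IsHermitian)
    (h0 : ∀ i j, 0 ≤ A i j) (h1 : ∀ i, ∑ j, A i j = 1) (τ : ℝ) (hτ : 0 ≤ τ) (y : Fin n → ℝ) :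
    ∑ i, ∑ j, A i j * y i * y j ≤ ∑ i, ∑ j, Pm hA τ i j * y i * y j + τ * ∑ i, y i ^ 2 := by
  have hP : ∑ i, ∑ j, Pm hA τ i j * y i * y j =
      ∑ r, if τ ≤ hA.eigenvalues r then (∑ i, hA.eigenvectorBasis r i * y i) ^ 2 else 0 := by
    rw [← Finset.sum_filter]
    unfold Pm
    simp_rw [sq, Finset.sum_mul_sum, Finset.sum_mul]
    rw [Finset.sum_comm_cycle]
    refine Finset.sum_congr rfl fun r _ => ?_
    refine Finset.sum_congr rfl fun i _ => Finset.sum_congr rfl fun j _ => ?_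
    ring
  rw [hP, quad_eig hA, norm_eig hA, Finset.mul_sum, ← Finset.sum_add_distrib]
  refine Finset.sum_le_sum fun r _ => ?_
  have := eig_le_one hA h0 h1 r
  have hsq := sq_nonneg (∑ i, hA.eigenvectorBasis r i * y i)
  split_ifs with h
  · nlinarith
  · push Not at h
    nlinarith

lemma local_global {n : ℕ} (hn : 0 < n) {A : Matrix (Fin n) (Fin n) ℝ} (hA : A.IsHermitian)
    (h0 : ∀ i j, 0 ≤ A i j) (h1 : ∀ i, ∑ j, A i j = 1) (τ : ℝ) (hτ : 0 ≤ τ)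
    (hr : 0 < rankGe hA τ) (e M : Fin n → Fin n → ℝ) (K : ℝ) (hK : 0 ≤ K)
    (heM : ∀ i j, e i j ^ 2 ≤ K * M i j) (hM0 : ∀ i j, 0 ≤ M i j) (hM1 : ∀ i, M i i ≤ 1)
    {ι : Type} [Fintype ι] (w : ι → ℝ) (hw : ∀ s, 0 ≤ w s) (U : Fin n → ι → ℝ)
    (hMU : ∀ i j, M i j = ∑ s, w s * U i s * U j s) (ε : ℝ)
    (hε : ε = (1 / (n : ℝ)) * ∑ i, ∑ j, A i j * e i j) (hKτ : K * τ ≤ ε ^ 2 / 4) :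
    ε ^ 2 / (4 * rankGe hA τ) ≤ K * ((1 / (n : ℝ) ^ 2) * ∑ i, ∑ j, M i j) := by
  set R : ℝ := (rankGe hA τ : ℝ) with hR
  have hRpos : 0 < R := by rw [hR]; exact_mod_cast hr
  have hnpos : (0 : ℝ) < n := by exact_mod_cast hn
  set t : Fin n → ℝ := fun i => Real.sqrt (Pm hA τ i i + R / n) with ht
  have htpos : ∀ i, 0 < t i := fun i =>
    Real.sqrt_pos.2 (by have := Pm_nonneg hA τ i; positivity)
  have htsq : ∀ i, t i ^ 2 = Pm hA τ i i + R / n := fun i =>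
    Real.sq_sqrt (by have := Pm_nonneg hA τ i; positivity)
  have htsum : ∑ i, t i ^ 2 = 2 * R := by
    simp_rw [htsq]
    rw [Finset.sum_add_distrib, Pm_trace]
    simp
    field_simp
    ring
  set d : Fin n → ℝ := fun i => (t i)⁻¹ with hd
  have hdpos : ∀ i, 0 < d i := fun i => inv_pos.2 (htpos i)
  have hdsq : ∀ i, d i ^ 2 ≤ n / R := by
    intro i
    rw [hd]
    simp only [inv_pow, htsq]
    rw [inv_le_comm₀ (by have := Pm_nonneg hA τ i; positivity) (by positivity), inv_div]
    linarith [Pm_nonneg hA τ i]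
  have hPd : ∀ i j, Pm hA τ i j * (d i * d j) ≤ 1 := by
    intro i j
    have : Pm hA τ i j ≤ t i * t j := by
      refine le_of_abs_le (abs_le_of_sq_le_sq ?_ (mul_pos (htpos i) (htpos j)).le)
      rw [mul_pow, htsq, htsq]
      refine (Pm_cs hA τ i j).trans ?_
      have a := Pm_nonneg hA τ i
      have b := Pm_nonneg hA τ j
      have c : 0 ≤ R / n := by positivity
      nlinarith [mul_nonneg a c, mul_nonneg b c, mul_nonneg c c]
    calc Pm hA τ i j * (d i * d j) ≤ (t i * t j) * (d i * d j) :=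
          mul_le_mul_of_nonneg_right this (mul_pos (hdpos i) (hdpos j)).le
      _ = 1 := by
          have := (htpos i).ne'
          have := (htpos j).ne'
          simp only [hd]; field_simp
  set S : ℝ := ∑ i, ∑ j, A i j * (d i * d j) * M i j with hS
  -- step 1
  have gram : ∀ B : Fin n → Fin n → ℝ, ∑ i, ∑ j, B i j * (d i * d j) * M i j
      = ∑ s, w s * ∑ i, ∑ j, B i j * (d i * U i s) * (d j * U j s) := by
    intro B
    simp_rw [hMU, Finset.mul_sum]
    rw [Finset.sum_comm_cycle]
    refine Finset.sum_congr rfl fun r _ => ?_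
    refine Finset.sum_congr rfl fun i _ => Finset.sum_congr rfl fun j _ => ?_
    ring
  have gramd : ∑ i, d i ^ 2 * M i i = ∑ s, w s * ∑ i, (d i * U i s) ^ 2 := by
    simp_rw [hMU, Finset.mul_sum]
    rw [Finset.sum_comm]
    refine Finset.sum_congr rfl fun r _ => Finset.sum_congr rfl fun i _ => ?_
    ring
  have s1 : S ≤ ∑ i, ∑ j, Pm hA τ i j * (d i * d j) * M i j + τ * ∑ i, d i ^ 2 * M i i := by
    rw [hS, gram (fun i j => A i j), gram, gramd, Finset.mul_sum, ← Finset.sum_add_distrib]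
    refine Finset.sum_le_sum fun s _ => ?_
    have := mul_le_mul_of_nonneg_left
      (quad_trunc hA h0 h1 τ hτ (fun i => d i * U i s)) (hw s)
    linarith
  have s2 : ∑ i, ∑ j, Pm hA τ i j * (d i * d j) * M i j ≤ ∑ i, ∑ j, M i j :=
    Finset.sum_le_sum fun i _ => Finset.sum_le_sum fun j _ => by
      have := mul_le_mul_of_nonneg_right (hPd i j) (hM0 i j)
      linarith
  have s3 : ∑ i, d i ^ 2 * M i i ≤ n * (n / R) := by
    calc ∑ i, d i ^ 2 * M i i ≤ ∑ i : Fin n, (n / R : ℝ) :=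
          Finset.sum_le_sum fun i _ => by
            have := mul_le_mul (hdsq i) (hM1 i) (hM0 i i) (by positivity)
            linarith
      _ = _ := by simp
  -- step 2
  have s4 : (∑ x : Fin n × Fin n, A x.1 x.2 * e x.1 x.2) ^ 2 ≤
      (∑ x : Fin n × Fin n, A x.1 x.2 * (d x.1 * d x.2) * e x.1 x.2 ^ 2) *
      (∑ x : Fin n × Fin n, A x.1 x.2 * t x.1 * t x.2) := by
    refine Finset.sum_sq_le_sum_mul_sum_of_sq_le_mul _ ?_ ?_ ?_
    · intro x _
      have := h0 x.1 x.2
      have := hdpos x.1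
      have := hdpos x.2
      positivity
    · intro x _
      have := h0 x.1 x.2
      have := htpos x.1
      have := htpos x.2
      positivity
    · intro x _
      have := (htpos x.1).ne'
      have := (htpos x.2).ne'
      apply le_of_eq
      simp only [hd]; field_simp
  simp_rw [Fintype.sum_prod_type] at s4
  have s5 : ∑ i, ∑ j, A i j * t i * t j ≤ 2 * R := (quad_le hA h0 h1 t).trans htsum.le
  have s6 : ∑ i, ∑ j, A i j * (d i * d j) * e i j ^ 2 ≤ K * S := by
    rw [hS, Finset.mul_sum]
    refine Finset.sum_le_sum fun i _ => ?_
    rw [Finset.mul_sum]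
    refine Finset.sum_le_sum fun j _ => ?_
    have := mul_le_mul_of_nonneg_left (heM i j)
      (mul_nonneg (h0 i j) (mul_pos (hdpos i) (hdpos j)).le)
    linarith
  have hS0 : 0 ≤ S := Finset.sum_nonneg fun i _ => Finset.sum_nonneg fun j _ =>
    mul_nonneg (mul_nonneg (h0 i j) (mul_pos (hdpos i) (hdpos j)).le) (hM0 i j)
  have s7 : (n * ε) ^ 2 ≤ K * S * (2 * R) := by
    have : (n : ℝ) * ε = ∑ i, ∑ j, A i j * e i j := by rw [hε]; field_simp
    rw [this]
    refine s4.trans ?_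
    refine (mul_le_mul_of_nonneg_left s5 ?_).trans (mul_le_mul_of_nonneg_right s6 (by positivity))
    exact Finset.sum_nonneg fun i _ => Finset.sum_nonneg fun j _ =>
      mul_nonneg (mul_nonneg (h0 i j) (mul_pos (hdpos i) (hdpos j)).le) (sq_nonneg _)
  set Q := ∑ i, ∑ j, M i j with hQ
  have s8 : S ≤ Q + τ * (n * (n / R)) := by
    have := mul_le_mul_of_nonneg_left s3 hτ
    linarith
  have s9 : R * S ≤ R * Q + τ * n ^ 2 := by
    have := mul_le_mul_of_nonneg_left s8 hRpos.le
    calc R * S ≤ _ := this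
      _ = _ := by field_simp
  have s10 : n ^ 2 * ε ^ 2 ≤ 4 * (K * (R * Q)) := by
    have a := mul_le_mul_of_nonneg_left s9 hK
    have b := mul_le_mul_of_nonneg_left hKτ (by positivity : (0:ℝ) ≤ n ^ 2)
    nlinarith
  rw [div_le_iff₀ (by positivity)]
  have : K * (1 / (n:ℝ) ^ 2 * Q) * (4 * R) = 4 * (K * (R * Q)) / n ^ 2 := by field_simp
  rw [this, le_div_iff₀ (by positivity)]
  linarith

lemma pCondVar_eq (p : Ω → ℝ) (hp : ∑ ω, p ω = 1) (f : Ω → ℝ) {k : ℕ} (Y : Ω → Fin k)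
    (hY : ∀ b, 0 < pProb p (fun ω => Y ω = b)) :
    pVar p f - pCondVar p f Y =
      ∑ b, ((∑ ω, if Y ω = b then p ω * f ω else 0) - pExp p f * pProb p (fun ω => Y ω = b)) ^ 2 /
        pProb p (fun ω => Y ω = b) := by
  have fib : ∀ g : Ω → ℝ, ∑ b, ∑ ω, (if Y ω = b then g ω else 0) = ∑ ω, g ω := by
    intro g
    rw [Finset.sum_comm]
    simp
  have e1 : pCondVar p f Y = ∑ b, ((∑ ω, if Y ω = b then p ω * f ω ^ 2 else 0) -
      (∑ ω, if Y ω = b then p ω * f ω else 0) ^ 2 / pProb p (fun ω => Y ω = b)) := by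
    unfold pCondVar
    rw [Finset.sum_subset (Finset.subset_univ _)]
    · refine Finset.sum_congr rfl fun b _ => ?_
      rw [if_pos (hY b)]
      have hb := (hY b).ne'
      have hP : pProb p (fun ω => Y ω = b) = ∑ ω, if Y ω = b then p ω else 0 := rfl
      set P := pProb p (fun ω => Y ω = b) with hPdef
      set F := ∑ ω, if Y ω = b then p ω * f ω else 0 with hF
      have hmu : pExp (pCond p (fun ω => Y ω = b)) f = F / P := by
        unfold pExp pCond
        rw [hF, Finset.sum_div]
        refine Finset.sum_congr rfl fun ω _ => ?_
        split_ifs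
        · rw [← hPdef]; ring
        · simp
      unfold pVar
      rw [hmu]
      have : P * pExp (pCond p (fun ω => Y ω = b)) (fun ω => (f ω - F / P) ^ 2) =
          ∑ ω, ((if Y ω = b then p ω * f ω ^ 2 else 0) - 2 * (F / P) * (if Y ω = b then p ω * f ω else 0)
            + (F / P) ^ 2 * (if Y ω = b then p ω else 0)) := by
        unfold pExp pCond
        rw [Finset.mul_sum]
        refine Finset.sum_congr rfl fun ω _ => ?_
        split_ifs
        · rw [← hPdef]; field_simp; ring
        · simp
      rw [this, Finset.sum_add_distrib, Finset.sum_sub_distrib, ← Finset.mul_sum, ← Finset.mul_sum,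
        ← hP, ← hF]
      field_simp
      ring
    · intro b _ hb
      exfalso
      have h := hY b
      have : pProb p (fun ω => Y ω = b) = 0 := by
        unfold pProb
        refine Finset.sum_eq_zero fun ω _ => if_neg fun h => hb ?_
        exact Finset.mem_image.2 ⟨ω, Finset.mem_univ _, h⟩
      linarith
  have e2 : pVar p f = pExp p (fun ω => f ω ^ 2) - pExp p f ^ 2 := by
    unfold pVar
    set m := pExp p f with hm
    have : pExp p (fun ω => (f ω - m) ^ 2) = ∑ ω, (p ω * f ω ^ 2 - 2 * m * (p ω * f ω) + m ^ 2 * p ω) :=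
      Finset.sum_congr rfl fun ω _ => by ring
    rw [this, Finset.sum_add_distrib, Finset.sum_sub_distrib, ← Finset.mul_sum, ← Finset.mul_sum, hp]
    have : ∑ ω, p ω * f ω = m := rfl
    rw [this]
    unfold pExp
    ring
  have e3 : ∀ b, ((∑ ω, if Y ω = b then p ω * f ω else 0) - pExp p f * pProb p (fun ω => Y ω = b)) ^ 2 /
        pProb p (fun ω => Y ω = b) = (∑ ω, if Y ω = b then p ω * f ω else 0) ^ 2 / pProb p (fun ω => Y ω = b)
        - 2 * pExp p f * (∑ ω, if Y ω = b then p ω * f ω else 0)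
        + pExp p f ^ 2 * pProb p (fun ω => Y ω = b) := by
    intro b
    have hb := (hY b).ne'
    field_simp
    ring
  simp_rw [e3]
  have e4 : ∑ b, pProb p (fun ω => Y ω = b) = 1 := by
    unfold pProb; rw [fib, hp]
  have e5 : ∑ ω, p ω * f ω = pExp p f := rfl
  have e6 : ∑ ω, p ω * f ω ^ 2 = pExp p (fun ω => f ω ^ 2) := rfl
  rw [e1, e2, Finset.sum_sub_distrib, Finset.sum_add_distrib, Finset.sum_sub_distrib, fib,
    ← Finset.mul_sum, ← Finset.mul_sum, fib, e4, e5, e6]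
  ring

lemma pCondVar_nonneg (p : Ω → ℝ) (hp0 : ∀ ω, 0 ≤ p ω) (f : Ω → ℝ) {k : ℕ} (Y : Ω → Fin k) :
    0 ≤ pCondVar p f Y := by
  unfold pCondVar
  refine Finset.sum_nonneg fun b _ => ?_
  split_ifs with h
  · refine mul_nonneg h.le ?_
    unfold pVar pExp
    refine Finset.sum_nonneg fun ω _ => mul_nonneg ?_ (sq_nonneg _)
    unfold pCond
    split_ifs
    · exact div_nonneg (hp0 ω) h.le
    · exact le_rfl
  · exact le_rfl

lemma pExp_ind (p : Ω → ℝ) {k : ℕ} (X : Ω → Fin k) (a : Fin k) :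
    pExp p (pInd X a) = pProb p (fun ω => X ω = a) := by
  unfold pExp pInd pProb
  simp

lemma pProb_pos_of_var (p : Ω → ℝ) (hp0 : ∀ ω, 0 ≤ p ω) {k : ℕ} (X : Ω → Fin k) (a : Fin k)
    (h : 0 < pVar p (pInd X a)) : 0 < pProb p (fun ω => X ω = a) := by
  have h0 : 0 ≤ pProb p (fun ω => X ω = a) :=
    Finset.sum_nonneg fun ω _ => by split_ifs; exacts [hp0 ω, le_rfl]
  rcases h0.lt_or_eq with h1 | h1
  · exact h1
  exfalso
  have h2 : ∀ ω, X ω = a → p ω = 0 := by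
    intro ω hω
    have := (Finset.sum_eq_zero_iff_of_nonneg (s := Finset.univ)
      (f := fun ω => if X ω = a then p ω else 0)
      (fun ω _ => by split_ifs; exacts [hp0 ω, le_rfl])).1 h1.symm ω (Finset.mem_univ _)
    simpa [hω] using this
  have : pVar p (pInd X a) = 0 := by
    unfold pVar
    rw [pExp_ind, ← h1]
    refine Finset.sum_eq_zero fun ω _ => ?_
    by_cases hω : X ω = a
    · simp [h2 ω hω]
    · simp [pInd, hω]
  linarith

lemma pProb_sum (p : Ω → ℝ) (hp : ∑ ω, p ω = 1) {k : ℕ} (X : Ω → Fin k) :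
    ∑ a, pProb p (fun ω => X ω = a) = 1 := by
  unfold pProb
  rw [Finset.sum_comm]
  simpa using hp

lemma pVarK_le_one (p : Ω → ℝ) (hp : ∑ ω, p ω = 1) {k : ℕ} (X : Ω → Fin k) : pVarK p X ≤ 1 := by
  rw [← pProb_sum p hp X]
  refine Finset.sum_le_sum fun a _ => ?_
  unfold pVar
  rw [pExp_ind]
  set m := pProb p (fun ω => X ω = a) with hm
  have : pExp p (fun ω => (pInd X a ω - m) ^ 2) =
      ∑ ω, ((if X ω = a then p ω else 0) - 2 * m * (if X ω = a then p ω else 0) + m ^ 2 * p ω) := by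
    refine Finset.sum_congr rfl fun ω _ => ?_
    unfold pInd
    by_cases h : X ω = a <;> simp [h] <;> ring
  have h2 : ∑ ω, (if X ω = a then p ω else 0) = m := rfl
  rw [this, Finset.sum_add_distrib, Finset.sum_sub_distrib, ← Finset.mul_sum, ← Finset.mul_sum, hp, h2]
  nlinarith [sq_nonneg m]

/-- covariance of the indicators -/
def cv (p : Ω → ℝ) {k : ℕ} (X Y : Ω → Fin k) (a b : Fin k) : ℝ :=
  pProb p (fun ω => X ω = a ∧ Y ω = b) - pProb p (fun ω => X ω = a) * pProb p (fun ω => Y ω = b)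

lemma cv_symm (p : Ω → ℝ) {k : ℕ} (X Y : Ω → Fin k) (a b : Fin k) : cv p X Y a b = cv p Y X b a := by
  unfold cv
  simp_rw [and_comm, mul_comm]

lemma cv_gram (p : Ω → ℝ) (hp : ∑ ω, p ω = 1) {k : ℕ} (X Y : Ω → Fin k) (a b : Fin k) :
    cv p X Y a b = ∑ ω, p ω * (pInd X a ω - pProb p (fun ω => X ω = a)) *
      (pInd Y b ω - pProb p (fun ω => Y ω = b)) := by
  set m := pProb p (fun ω => X ω = a) with hm
  set l := pProb p (fun ω => Y ω = b) with hl
  have : ∑ ω, p ω * (pInd X a ω - m) * (pInd Y b ω - l) =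
      ∑ ω, ((if X ω = a ∧ Y ω = b then p ω else 0) - l * (if X ω = a then p ω else 0)
        - m * (if Y ω = b then p ω else 0) + m * l * p ω) := by
    refine Finset.sum_congr rfl fun ω _ => ?_
    unfold pInd
    by_cases h1 : X ω = a <;> by_cases h2 : Y ω = b <;> simp [h1, h2] <;> ring
  have h1 : ∑ ω, (if X ω = a then p ω else 0) = m := rfl
  have h2 : ∑ ω, (if Y ω = b then p ω else 0) = l := rfl
  rw [this, Finset.sum_add_distrib, Finset.sum_sub_distrib, Finset.sum_sub_distrib,
    ← Finset.mul_sum, ← Finset.mul_sum, ← Finset.mul_sum, hp, h1, h2]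
  unfold cv
  rw [← hm, ← hl]
  unfold pProb
  ring

lemma decr_eq (p : Ω → ℝ) (hp : ∑ ω, p ω = 1) {k : ℕ} (X Y : Ω → Fin k)
    (hY : ∀ b, 0 < pProb p (fun ω => Y ω = b)) :
    pVarK p X - pCondVarK p X Y =
      ∑ a, ∑ b, cv p X Y a b ^ 2 / pProb p (fun ω => Y ω = b) := by
  unfold pVarK pCondVarK
  rw [← Finset.sum_sub_distrib]
  refine Finset.sum_congr rfl fun a _ => ?_
  rw [pCondVar_eq p hp _ Y hY]
  refine Finset.sum_congr rfl fun b _ => ?_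
  rw [pExp_ind]
  congr 2
  unfold cv
  congr 1
  unfold pProb pInd
  refine Finset.sum_congr rfl fun ω _ => ?_
  by_cases h1 : X ω = a <;> by_cases h2 : Y ω = b <;> simp [h1, h2]

/-- the normalized squared correlation -/
def Mm (p : Ω → ℝ) {k : ℕ} (X Y : Ω → Fin k) : ℝ :=
  ∑ a, ∑ b, cv p X Y a b ^ 2 *
    ((Real.sqrt (pProb p (fun ω => X ω = a)))⁻¹ * (Real.sqrt (pProb p (fun ω => Y ω = b)))⁻¹)

lemma Mm_le (p : Ω → ℝ) (hp : ∑ ω, p ω = 1) {k : ℕ} (X Y : Ω → Fin k)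
    (hX : ∀ b, 0 < pProb p (fun ω => X ω = b)) (hY : ∀ b, 0 < pProb p (fun ω => Y ω = b)) :
    2 * Mm p X Y ≤ (pVarK p X - pCondVarK p X Y) + (pVarK p Y - pCondVarK p Y X) := by
  rw [decr_eq p hp X Y hY, decr_eq p hp Y X hX, Finset.sum_comm (f := fun a b => cv p Y X a b ^ 2 / _)]
  unfold Mm
  rw [Finset.mul_sum, ← Finset.sum_add_distrib]
  refine Finset.sum_le_sum fun a _ => ?_
  rw [Finset.mul_sum, ← Finset.sum_add_distrib]
  refine Finset.sum_le_sum fun b _ => ?_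
  rw [cv_symm p Y X b a]
  have h1 : (pProb p (fun ω => X ω = a))⁻¹ = (Real.sqrt (pProb p (fun ω => X ω = a)))⁻¹ ^ 2 := by
    rw [inv_pow, Real.sq_sqrt (hX a).le]
  have h2 : (pProb p (fun ω => Y ω = b))⁻¹ = (Real.sqrt (pProb p (fun ω => Y ω = b)))⁻¹ ^ 2 := by
    rw [inv_pow, Real.sq_sqrt (hY b).le]
  rw [div_eq_mul_inv, div_eq_mul_inv, h1, h2]
  set u := (Real.sqrt (pProb p (fun ω => X ω = a)))⁻¹
  set v := (Real.sqrt (pProb p (fun ω => Y ω = b)))⁻¹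
  nlinarith [mul_nonneg (sq_nonneg (cv p X Y a b)) (sq_nonneg (u - v))]

lemma Mm_nonneg (p : Ω → ℝ) {k : ℕ} (X Y : Ω → Fin k) : 0 ≤ Mm p X Y :=
  Finset.sum_nonneg fun a _ => Finset.sum_nonneg fun b _ => by positivity

lemma sum_sqrt (p : Ω → ℝ) (hp : ∑ ω, p ω = 1) {k : ℕ} (X : Ω → Fin k)
    (hX : ∀ b, 0 < pProb p (fun ω => X ω = b)) :
    ∑ a, Real.sqrt (pProb p (fun ω => X ω = a)) ≤ Real.sqrt k := by
  apply Real.le_sqrt_of_sq_le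
  have := sq_sum_le_card_mul_sum_sq (s := (Finset.univ : Finset (Fin k)))
    (f := fun a => Real.sqrt (pProb p (fun ω => X ω = a)))
  simp_rw [fun a => Real.sq_sqrt (hX a).le] at this
  rw [pProb_sum p hp] at this
  simpa using this

lemma l1_sq_le (p : Ω → ℝ) (hp : ∑ ω, p ω = 1) {k : ℕ} (X Y : Ω → Fin k)
    (hX : ∀ b, 0 < pProb p (fun ω => X ω = b)) (hY : ∀ b, 0 < pProb p (fun ω => Y ω = b)) :
    (∑ a, ∑ b, |cv p X Y a b|) ^ 2 ≤ k * Mm p X Y := by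
  have h := Finset.sum_sq_le_sum_mul_sum_of_sq_le_mul (Finset.univ : Finset (Fin k × Fin k))
    (r := fun x => |cv p X Y x.1 x.2|)
    (f := fun x => cv p X Y x.1 x.2 ^ 2 *
      ((Real.sqrt (pProb p (fun ω => X ω = x.1)))⁻¹ * (Real.sqrt (pProb p (fun ω => Y ω = x.2)))⁻¹))
    (g := fun x => Real.sqrt (pProb p (fun ω => X ω = x.1)) * Real.sqrt (pProb p (fun ω => Y ω = x.2)))
    (fun x _ => by positivity) (fun x _ => by positivity) (fun x _ => by
      have h1 := (Real.sqrt_pos.2 (hX x.1)).ne'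
      have h2 := (Real.sqrt_pos.2 (hY x.2)).ne'
      apply le_of_eq
      rw [sq_abs]
      field_simp)
  simp_rw [Fintype.sum_prod_type] at h
  have hprod : ∑ a, ∑ b, Real.sqrt (pProb p (fun ω => X ω = a)) * Real.sqrt (pProb p (fun ω => Y ω = b))
      = (∑ a, Real.sqrt (pProb p (fun ω => X ω = a))) * ∑ b, Real.sqrt (pProb p (fun ω => Y ω = b)) := by
    rw [Finset.sum_mul]
    exact Finset.sum_congr rfl fun a _ => by rw [Finset.mul_sum]
  refine h.trans ?_
  rw [hprod]
  rw [mul_comm]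
  refine mul_le_mul_of_nonneg_right ?_ (Mm_nonneg p X Y)
  calc _ ≤ Real.sqrt k * Real.sqrt k := mul_le_mul (sum_sqrt p hp X hX) (sum_sqrt p hp Y hY)
        (Finset.sum_nonneg fun _ _ => Real.sqrt_nonneg _) (Real.sqrt_nonneg _)
    _ = k := Real.mul_self_sqrt (Nat.cast_nonneg k)

/-- Gram vectors -/
def Uv (p : Ω → ℝ) {k : ℕ} (X : Ω → Fin k) (s : Ω × Ω) : ℝ :=
  ∑ a, (Real.sqrt (pProb p (fun ω => X ω = a)))⁻¹ *
    ((pInd X a s.1 - pProb p (fun ω => X ω = a)) * (pInd X a s.2 - pProb p (fun ω => X ω = a)))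

lemma Mm_gram (p : Ω → ℝ) (hp : ∑ ω, p ω = 1) {k : ℕ} (X Y : Ω → Fin k) :
    Mm p X Y = ∑ s : Ω × Ω, (p s.1 * p s.2) * Uv p X s * Uv p Y s := by
  have hR : ∀ s : Ω × Ω, (p s.1 * p s.2) * Uv p X s * Uv p Y s = ∑ a, ∑ b,
      (p s.1 * p s.2) * (((Real.sqrt (pProb p (fun ω => X ω = a)))⁻¹ *
    ((pInd X a s.1 - pProb p (fun ω => X ω = a)) * (pInd X a s.2 - pProb p (fun ω => X ω = a)))) *
    ((Real.sqrt (pProb p (fun ω => Y ω = b)))⁻¹ *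
    ((pInd Y b s.1 - pProb p (fun ω => Y ω = b)) * (pInd Y b s.2 - pProb p (fun ω => Y ω = b))))) := by
    intro s
    unfold Uv
    rw [mul_assoc, Finset.sum_mul, Finset.mul_sum]
    refine Finset.sum_congr rfl fun a _ => ?_
    rw [Finset.mul_sum, Finset.mul_sum]
  rw [Finset.sum_congr rfl fun s _ => hR s, Finset.sum_comm]
  unfold Mm
  refine Finset.sum_congr rfl fun a _ => ?_
  rw [Finset.sum_comm]
  refine Finset.sum_congr rfl fun b _ => ?_
  rw [cv_gram p hp, sq, Fintype.sum_prod_type, Finset.sum_mul, Finset.sum_mul]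
  refine Finset.sum_congr rfl fun ω _ => ?_
  rw [Finset.mul_sum, Finset.sum_mul]
  refine Finset.sum_congr rfl fun ω' _ => ?_
  ring

/-- There are absolute constants `c₁, c₂ > 0` such that, for a regular
weighted graph `G` with normalized adjacency matrix `A` and jointly distributed
`[k]`-valued random variables `X₁, …, Xₙ` with positive indicator variances, if `ε` is the
expected ℓ¹-distance between correlated and independent sampling across the edges of `G`,
then conditioning on a random vertex decreases the average variance:
`E_{i,j∈V} E_{{X_j}} Var[X_i | X_j] ≤ E_{i∈V} Var X_i − c₁ ε² / (k · rank_{≥ c₂ ε²/k²}(G))`. -/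
theorem stmt_7 :
    ∃ c₁ c₂ : ℝ, 0 < c₁ ∧ 0 < c₂ ∧
      ∀ (n : ℕ), 0 < n →
      ∀ (A : Matrix (Fin n) (Fin n) ℝ) (hA : A.IsHermitian),
        (∀ i j, 0 ≤ A i j) → (∀ i, ∑ j, A i j = 1) →
      ∀ (Ω : Type) (_ : Fintype Ω) (p : Ω → ℝ),
        (∀ ω, 0 ≤ p ω) → (∑ ω, p ω = 1) →
      ∀ (k : ℕ), 0 < k →
      ∀ (X : Fin n → Ω → Fin k),
        (∀ i a, 0 < pVar p (pInd (X i) a)) →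
      ∀ (ε : ℝ),
        ε = (1 / (n : ℝ)) * ∑ i, ∑ j, A i j *
              ∑ a : Fin k, ∑ b : Fin k,
                |pProb p (fun ω => X i ω = a ∧ X j ω = b) -
                  pProb p (fun ω => X i ω = a) * pProb p (fun ω => X j ω = b)| →
        (1 / (n : ℝ) ^ 2) * ∑ i, ∑ j, pCondVarK p (X i) (X j) ≤
          (1 / (n : ℝ)) * ∑ i, pVarK p (X i) -
            c₁ * ε ^ 2 / ((k : ℝ) * (rankGe hA (c₂ * ε ^ 2 / (k : ℝ) ^ 2) : ℝ)) := by
  refine ⟨1 / 4, 1 / 4, by norm_num, by norm_num, ?_⟩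
  intro n hn A hA h0 h1 Ω _ p hp0 hp k hk X hv ε hε
  have hP : ∀ i a, 0 < pProb p (fun ω => X i ω = a) := fun i a => pProb_pos_of_var p hp0 _ a (hv i a)
  have hnpos : (0 : ℝ) < n := by exact_mod_cast hn
  have hkpos : (1 : ℝ) ≤ k := by exact_mod_cast hk
  set τ : ℝ := 1 / 4 * ε ^ 2 / (k : ℝ) ^ 2 with hτ
  have hτ0 : 0 ≤ τ := by positivity
  set Q := ∑ i, ∑ j, Mm p (X i) (X j) with hQ
  have hQ0 : 0 ≤ Q := Finset.sum_nonneg fun i _ => Finset.sum_nonneg fun j _ => Mm_nonneg p _ _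
  have key : 1 / 4 * ε ^ 2 / ((k : ℝ) * (rankGe hA τ : ℝ)) ≤ 1 / (n : ℝ) ^ 2 * Q := by
    rcases Nat.eq_zero_or_pos (rankGe hA τ) with hr | hr
    · rw [hr]
      simp only [Nat.cast_zero, mul_zero, div_zero]
      positivity
    · have hrpos : (0 : ℝ) < rankGe hA τ := by exact_mod_cast hr
      have := local_global hn hA h0 h1 τ hτ0 hr (fun i j => ∑ a, ∑ b, |cv p (X i) (X j) a b|)
        (fun i j => Mm p (X i) (X j)) k (by linarith)
        (fun i j => l1_sq_le p hp _ _ (hP i) (hP j)) (fun i j => Mm_nonneg p _ _)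
        (fun i => by
          have a := Mm_le p hp (X i) (X i) (hP i) (hP i)
          have b := pVarK_le_one p hp (X i)
          have c : 0 ≤ pCondVarK p (X i) (X i) :=
            Finset.sum_nonneg fun a _ => pCondVar_nonneg p hp0 _ _
          linarith)
        (fun s : Ω × Ω => p s.1 * p s.2) (fun s => mul_nonneg (hp0 _) (hp0 _))
        (fun i => Uv p (X i)) (fun i j => Mm_gram p hp _ _) ε hε
        (by
          have : (k : ℝ) * τ = ε ^ 2 / 4 / k := by rw [hτ]; field_simp
          rw [this]
          exact div_le_self (by positivity) hkpos)
      calc 1 / 4 * ε ^ 2 / ((k : ℝ) * (rankGe hA τ : ℝ)) = (ε ^ 2 / (4 * rankGe hA τ)) / k := by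
            field_simp
        _ ≤ _ := by
            rw [div_le_iff₀ (by linarith)]
            linarith
  have hD : 2 * Q ≤ 2 * (n * ∑ i, pVarK p (X i) - ∑ i, ∑ j, pCondVarK p (X i) (X j)) := by
    have a : 2 * Q ≤ ∑ i, ∑ j, ((pVarK p (X i) - pCondVarK p (X i) (X j)) +
        (pVarK p (X j) - pCondVarK p (X j) (X i))) := by
      rw [hQ, Finset.mul_sum]
      refine Finset.sum_le_sum fun i _ => ?_
      rw [Finset.mul_sum]
      exact Finset.sum_le_sum fun j _ => Mm_le p hp _ _ (hP i) (hP j)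
    refine a.trans (le_of_eq ?_)
    simp_rw [Finset.sum_add_distrib, Finset.sum_sub_distrib]
    rw [Finset.sum_comm (f := fun i j => pCondVarK p (X j) (X i))]
    simp only [Finset.sum_const, Finset.card_univ, Fintype.card_fin, nsmul_eq_mul, ← Finset.mul_sum]
    ring
  have hD2 : 1 / (n : ℝ) ^ 2 * Q ≤ 1 / (n : ℝ) * ∑ i, pVarK p (X i) -
      1 / (n : ℝ) ^ 2 * ∑ i, ∑ j, pCondVarK p (X i) (X j) := by
    have : 1 / (n : ℝ) ^ 2 * Q ≤ 1 / (n : ℝ) ^ 2 *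
      (n * ∑ i, pVarK p (X i) - ∑ i, ∑ j, pCondVarK p (X i) (X j)) :=
      mul_le_mul_of_nonneg_left (by linarith) (by positivity)
    refine this.trans (le_of_eq ?_)
    field_simp
  linarith

end
end

section
/- Let v₁, …, vₙ be vectors in a real inner product space H with ‖v_i‖ ≤ 1 for all i, and suppose that for every subset U ⊆ {1, …, n} we are given an orthogonal projection Q_U of H whose range is orthogonal to the span of {v_j : j ∈ U}. Then for every ε > 0 there exists a subset U ⊆ {1, …, n} with |U| ≤ 1/ε such that, letting w_i := Q_U v_i, one has E_{i,j∈[n]} ⟨w_i, w_j⟩² / (‖w_i‖·‖w_j‖) ≤ ε, where a term is interpreted as 0 whenever w_i = 0 or w_j = 0. -/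
open Finset RealInnerProductSpace

noncomputable section

open Matrix MatrixOrder in
lemma aux_quad_le_trace {n : ℕ} (S : Matrix (Fin n) (Fin n) ℝ) (hS : S.PosSemidef)
    (y : Fin n → ℝ) : y ⬝ᵥ (S *ᵥ y) ≤ S.trace * (y ⬝ᵥ y) := by
  obtain ⟨B, rfl⟩ : ∃ B : Matrix (Fin n) (Fin n) ℝ, S = Bᵀ * B := by
    obtain ⟨B, hB⟩ := CStarAlgebra.nonneg_iff_eq_star_mul_self.mp hS.nonneg
    exact ⟨B, by simpa [Matrix.star_eq_conjTranspose] using hB⟩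
  have h1 : y ⬝ᵥ ((Bᵀ * B) *ᵥ y) = ∑ i, (∑ j, B i j * y j) ^ 2 := by
    rw [← Matrix.mulVec_mulVec, Matrix.dotProduct_mulVec, Matrix.vecMul_transpose]
    simp [dotProduct, Matrix.mulVec, sq]
  have h2 : (Bᵀ * B).trace = ∑ i, ∑ j, B i j ^ 2 := by
    simp only [Matrix.trace, Matrix.diag, Matrix.mul_apply, Matrix.transpose_apply, ← sq]
    rw [Finset.sum_comm]
  rw [h1, h2, Finset.sum_mul]
  apply Finset.sum_le_sum
  intro i _
  have := Finset.sum_mul_sq_le_sq_mul_sq Finset.univ (fun j => B i j) y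
  simpa [dotProduct, sq] using this

open Matrix MatrixOrder in
lemma aux_step1 {n : ℕ} (S : Matrix (Fin n) (Fin n) ℝ) (hS : S.PosSemidef)
    (htr : S.trace < 1) : ∃ T : Matrix (Fin n) (Fin n) ℝ, T.PosSemidef ∧
      (∀ s y : Fin n → ℝ, s ⬝ᵥ (S *ᵥ s) ≤ (s - y) ⬝ᵥ (s - y) + y ⬝ᵥ (T *ᵥ y)) ∧
      (∀ c : ℝ, 0 ≤ S.trace - 2 * c * T.trace + c ^ 2 * (T.trace + (T * T).trace)) := by
  have hSt : Sᵀ = S := by simpa using hS.1.eq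
  have hC : (1 - S).PosDef := by
    refine Matrix.PosDef.of_dotProduct_mulVec_pos (by
      rw [Matrix.IsHermitian]; simp [hSt]) ?_
    intro x hx
    have h := aux_quad_le_trace S hS x
    have hp : 0 < x ⬝ᵥ x := by
      have := Matrix.dotProduct_star_self_pos_iff (v := x)
      simpa using this.2 hx
    simp only [star_trivial, Matrix.sub_mulVec, Matrix.one_mulVec, dotProduct_sub]
    nlinarith
  set R := (1 - S)⁻¹ with hR
  have hdet : IsUnit (1 - S).det := (Matrix.isUnit_iff_isUnit_det _).1 hC.isUnit
  have hRC : R * (1 - S) = 1 := Matrix.nonsing_inv_mul _ hdet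
  have hCR : (1 - S) * R = 1 := Matrix.mul_nonsing_inv _ hdet
  have hRp : R.PosSemidef := hC.inv.posSemidef
  have hRt : Rᵀ = R := by simpa using hRp.1.eq
  have e1 : R * S = R - 1 := by rw [mul_sub, mul_one] at hRC; rw [← hRC]; abel
  have e2 : S * R = R - 1 := by rw [sub_mul, one_mul] at hCR; rw [← hCR]; abel
  have hTR : S + S * R * S = R - 1 := by
    rw [e2, sub_mul, e1]; simp
  have hT : (R - 1).PosSemidef := by
    rw [← hTR]
    refine hS.add ?_
    have := hRp.mul_mul_conjTranspose_same S
    simpa [hSt] using this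
  refine ⟨R - 1, hT, ?_, ?_⟩
  · intro s y
    have h := hRp.dotProduct_mulVec_nonneg ((1 - S) *ᵥ s - y)
    rw [star_trivial, Matrix.mulVec_sub, Matrix.mulVec_mulVec, hRC, Matrix.one_mulVec] at h
    have h3 : ((1 - S) *ᵥ s) ⬝ᵥ (R *ᵥ y) = s ⬝ᵥ y := by
      rw [Matrix.dotProduct_mulVec, ← Matrix.mulVec_transpose, hRt, Matrix.mulVec_mulVec, hRC,
        Matrix.one_mulVec]
    rw [dotProduct_sub, sub_dotProduct, sub_dotProduct, h3] at h
    simp only [Matrix.sub_mulVec, Matrix.one_mulVec, dotProduct_sub, sub_dotProduct] at h ⊢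
    have h4 := dotProduct_comm (S *ᵥ s) s
    have h5 := dotProduct_comm y s
    linarith
  · intro c
    have h := (hS.mul_mul_conjTranspose_same (1 - c • R)).trace_nonneg
    have h6 : (1 - c • R)ᴴ = 1 - c • R := by
      simp [hRt]
    have h7 : (1 - c • R) * S * (1 - c • R) =
        S - (2 * c) • (R - 1) + c ^ 2 • ((R - 1) + (R - 1) * (R - 1)) := by
      have e3 : (1 - c • R) * S = S - c • (R - 1) := by
        rw [sub_mul, one_mul, Matrix.smul_mul, e1]
      rw [e3, mul_sub, mul_one, Matrix.mul_smul, sub_mul, Matrix.smul_mul, e2]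
      have e4 : (R - 1) + (R - 1) * (R - 1) = (R - 1) * R := by noncomm_ring
      rw [e4]
      module
    rw [h6, h7] at h
    rw [Matrix.trace_add, Matrix.trace_sub, Matrix.trace_smul, Matrix.trace_smul,
      Matrix.trace_add] at h
    simpa only [smul_eq_mul] using h

open Matrix MatrixOrder in
lemma aux_step2 {n : ℕ} (hn : 0 < n) (T : Matrix (Fin n) (Fin n) ℝ) (hT : T.PosSemidef)
    (htr : 0 < T.trace → T.trace ^ 2 < T.trace + (T * T).trace) :
    ∃ (j : Fin n) (S : Matrix (Fin n) (Fin n) ℝ), S.PosSemidef ∧ S.trace < 1 ∧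
      (∀ y : Fin n → ℝ, ∃ c : ℝ,
        y ⬝ᵥ (S *ᵥ y) = (y + Pi.single j c) ⬝ᵥ (T *ᵥ (y + Pi.single j c))) := by
  have hTt : ∀ i j, T i j = T j i := fun i j => by
    have := congrFun (congrFun hT.1.eq j) i
    simpa using this
  have hnn : ∀ i, 0 ≤ T i i := fun i => hT.diag_nonneg
  rcases (hT.trace_nonneg).eq_or_lt with h0 | hpos
  · exact ⟨⟨0, hn⟩, T, hT, by linarith, fun y => ⟨0, by simp⟩⟩
  have hlt := htr hpos
  have hTT : (T * T).trace = ∑ j, ∑ i, T i j ^ 2 := by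
    simp only [Matrix.trace, Matrix.diag, Matrix.mul_apply]
    refine Finset.sum_congr rfl fun i _ => Finset.sum_congr rfl fun j _ => ?_
    rw [hTt i j]; ring
  obtain ⟨j, hj⟩ : ∃ j, (T.trace - 1) * T j j < ∑ i, T i j ^ 2 := by
    by_contra! hcon
    have := Finset.sum_le_sum (fun j (_ : j ∈ Finset.univ) => hcon j)
    rw [← Finset.mul_sum, ← hTT] at this
    have h' : ∑ i, T i i = T.trace := rfl
    rw [h'] at this
    nlinarith
  have hquad : ∀ (y : Fin n → ℝ) (c : ℝ), (y + Pi.single j c) ⬝ᵥ (T *ᵥ (y + Pi.single j c)) =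
      y ⬝ᵥ (T *ᵥ y) + 2 * c * (T *ᵥ y) j + c ^ 2 * T j j := by
    intro y c
    have hc : y ⬝ᵥ (T *ᵥ Pi.single j c) = c * (T *ᵥ y) j := by
      rw [Matrix.mulVec_single]
      simp only [dotProduct, Matrix.mulVec, Finset.mul_sum]
      refine Finset.sum_congr rfl fun i _ => ?_
      simp only [Pi.smul_apply, Matrix.col_apply, op_smul_eq_smul, smul_eq_mul, hTt i j]
      ring
    rw [Matrix.mulVec_add, add_dotProduct, dotProduct_add, dotProduct_add, hc]
    simp
    ring
  have hjj : 0 < T j j := by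
    rcases (hnn j).eq_or_lt with h | h
    · exfalso
      have hz : ∀ i, T i j = 0 := by
        intro i
        have hq : ∀ c : ℝ, 0 ≤ T i i + 2 * c * T i j := by
          intro c
          have h1 := hT.dotProduct_mulVec_nonneg (Pi.single i 1 + Pi.single j c)
          rw [star_trivial, hquad] at h1
          simpa [← h, hTt j i] using h1
        by_contra hne
        have := hq (-(T i i + 1) / (2 * T i j))
        have e : 2 * (-(T i i + 1) / (2 * T i j)) * T i j = -(T i i + 1) := by field_simp
        rw [e] at this
        linarith
      simp [hz] at hj
    · exact h
  have key : ∀ y : Fin n → ℝ,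
      y ⬝ᵥ ((T - (T j j)⁻¹ • Matrix.vecMulVec (fun i => T i j) (fun i => T i j)) *ᵥ y) =
      (y + Pi.single j (-(T *ᵥ y) j / T j j)) ⬝ᵥ
        (T *ᵥ (y + Pi.single j (-(T *ᵥ y) j / T j j))) := by
    intro y
    rw [hquad]
    have hd : (fun i => T i j) ⬝ᵥ y = (T *ᵥ y) j := by
      simp only [dotProduct, Matrix.mulVec]
      exact Finset.sum_congr rfl fun i _ => by rw [hTt i j]
    have hd2 : y ⬝ᵥ (fun i => T i j) = (T *ᵥ y) j := by rw [dotProduct_comm, hd]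
    rw [Matrix.sub_mulVec, Matrix.smul_mulVec, Matrix.vecMulVec_mulVec, hd, dotProduct_sub,
      dotProduct_smul]
    simp only [op_smul_eq_smul, dotProduct_smul, hd2, smul_eq_mul]
    field_simp
    ring
  refine ⟨j, T - (T j j)⁻¹ • Matrix.vecMulVec (fun i => T i j) (fun i => T i j), ?_, ?_,
    fun y => ⟨_, key y⟩⟩
  · refine Matrix.PosSemidef.of_dotProduct_mulVec_nonneg ?_ ?_
    · ext a b
      simp [Matrix.vecMulVec_apply, hTt b a, mul_comm]
    · intro y
      rw [star_trivial, key]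
      have := hT.dotProduct_mulVec_nonneg (y + Pi.single j (-(T *ᵥ y) j / T j j))
      simpa using this
  · have e : (Matrix.vecMulVec (fun i => T i j) (fun i => T i j)).trace = ∑ i, T i j ^ 2 := by
      simp [Matrix.trace, Matrix.vecMulVec_apply, sq]
    rw [Matrix.trace_sub, Matrix.trace_smul, e, smul_eq_mul]
    have : T.trace - 1 < (T j j)⁻¹ * ∑ i, T i j ^ 2 := by
      rw [inv_mul_eq_div, lt_div_iff₀ hjj]; exact hj
    linarith

open Matrix MatrixOrder in
lemma aux_main {H : Type*} [NormedAddCommGroup H] [InnerProductSpace ℝ H]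
    (n : ℕ) (hn : 0 < n) (x : Fin n → H) (hx : ∑ i, ‖x i‖ ^ 2 < 1) (k : ℕ) :
    ∃ U : Finset (Fin n), U.card ≤ k ∧ ∃ S : Matrix (Fin n) (Fin n) ℝ, S.PosSemidef ∧
      S.trace < 1 ∧ ∀ u : H, (∀ j ∈ U, (⟪x j, u⟫ : ℝ) = 0) → ∀ y : Fin n → ℝ,
        2 * ((fun i => (⟪x i, u⟫ : ℝ)) ⬝ᵥ y) - y ⬝ᵥ (S *ᵥ y) +
          k * ((fun i => (⟪x i, u⟫ : ℝ)) ⬝ᵥ (fun i => (⟪x i, u⟫ : ℝ))) ≤ ‖u‖ ^ 2 := by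
  induction k with
  | zero =>
    have hq : ∀ y : Fin n → ℝ, y ⬝ᵥ ((Matrix.of fun i j => (⟪x i, x j⟫ : ℝ)) *ᵥ y) =
        ‖∑ i, y i • x i‖ ^ 2 := by
      intro y
      rw [← real_inner_self_eq_norm_sq, sum_inner]
      simp only [inner_sum, dotProduct, Matrix.mulVec, Matrix.of_apply, real_inner_smul_left,
        real_inner_smul_right, Finset.mul_sum]
      refine Finset.sum_congr rfl fun i _ => Finset.sum_congr rfl fun j _ => ?_
      ring
    refine ⟨∅, by simp, Matrix.of fun i j => (⟪x i, x j⟫ : ℝ), ?_, ?_, ?_⟩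
    · refine Matrix.PosSemidef.of_dotProduct_mulVec_nonneg ?_ ?_
      · ext a b
        simp [real_inner_comm]
      · intro y
        rw [star_trivial, hq]; positivity
    · simpa [Matrix.trace] using hx
    · intro u _ y
      rw [hq]
      have h1 : (fun i => (⟪x i, u⟫ : ℝ)) ⬝ᵥ y = ⟪u, ∑ i, y i • x i⟫ := by
        rw [inner_sum]
        simp only [dotProduct, real_inner_smul_right]
        exact Finset.sum_congr rfl fun i _ => by rw [real_inner_comm]; ring
      have h2 := norm_sub_sq_real u (∑ i, y i • x i)
      have h3 := sq_nonneg ‖u - ∑ i, y i • x i‖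
      rw [h1]
      push_cast
      linarith
  | succ k ih =>
    obtain ⟨U, hU, S, hS, htr, hI⟩ := ih
    obtain ⟨T, hT, hST, hc⟩ := aux_step1 S hS htr
    obtain ⟨j, S', hS', htr', hq⟩ := aux_step2 hn T hT (by
      intro hp
      have h2 : 0 ≤ (T * T).trace := by
        have := (Matrix.posSemidef_conjTranspose_mul_self T).trace_nonneg
        rwa [hT.1.eq] at this
      have hQ : 0 < T.trace + (T * T).trace := by linarith
      have h := hc (T.trace / (T.trace + (T * T).trace))
      generalize T.trace + (T * T).trace = q at *
      have e : S.trace - 2 * (T.trace / q) * T.trace + (T.trace / q) ^ 2 * q =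
        S.trace - T.trace ^ 2 / q := by field_simp; ring
      rw [e] at h
      have h4 : T.trace ^ 2 / q < 1 := by linarith
      rwa [div_lt_one hQ] at h4)
    refine ⟨insert j U, (Finset.card_insert_le _ _).trans (by omega), S', hS', htr', ?_⟩
    intro u hu y
    obtain ⟨c, hyc⟩ := hq y
    rw [hyc]
    have hj : (⟪x j, u⟫ : ℝ) = 0 := hu j (by simp)
    have hI' := hI u (fun i hi => hu i (by simp [hi]))
    set a : Fin n → ℝ := fun i => (⟪x i, u⟫ : ℝ) with ha
    have e1 : a ⬝ᵥ (y + Pi.single j c) = a ⬝ᵥ y := by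
      rw [dotProduct_add, dotProduct_single]
      simp [ha, hj]
    rw [← e1]
    set z := y + Pi.single j c
    have h1 := hI' (z + a)
    have h2 := hST (z + a) z
    rw [add_sub_cancel_left] at h2
    rw [dotProduct_add] at h1
    push_cast
    linarith

/-- **low-rank approximation with general projectors.** Given vectors
`v₁, …, vₙ` in the unit ball of a real inner product space `H`, and for every subset `U`
an orthogonal projection `Q U` (a self-adjoint idempotent continuous linear map) whose
range is orthogonal to the span of `{v_j : j ∈ U}`, for every `ε > 0` there is a subset
`U` with `|U| ≤ 1/ε` such that, letting `w_i := Q U (v_i)`, one has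
`E_{i,j} ⟨w_i, w_j⟩²/(‖w_i‖·‖w_j‖) ≤ ε` (terms with a zero vector are `0`, which is the
Lean convention for division by zero). -/
theorem stmt_11 {H : Type*} [NormedAddCommGroup H] [InnerProductSpace ℝ H]
    (n : ℕ) (hn : 0 < n) (v : Fin n → H) (hv : ∀ i, ‖v i‖ ≤ 1)
    (Q : Finset (Fin n) → H →L[ℝ] H)
    (hQsa : ∀ U, ∀ x y : H, (⟪Q U x, y⟫ : ℝ) = ⟪x, Q U y⟫)
    (hQidem : ∀ U, ∀ x : H, Q U (Q U x) = Q U x)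
    (hQorth : ∀ U, ∀ j ∈ U, ∀ x : H, (⟪Q U x, v j⟫ : ℝ) = 0)
    (ε : ℝ) (hε : 0 < ε) :
    ∃ U : Finset (Fin n), (U.card : ℝ) ≤ 1 / ε ∧
      (1 / (n : ℝ) ^ 2) * ∑ i, ∑ j,
          (⟪Q U (v i), Q U (v j)⟫ : ℝ) ^ 2 / (‖Q U (v i)‖ * ‖Q U (v j)‖) ≤ ε := by
  have hn' : (0:ℝ) < n := by exact_mod_cast hn
  set k := ⌊1 / ε⌋₊ with hk
  have hk1 : 1 / ε < (k:ℝ) + 1 := Nat.lt_floor_add_one _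
  have hk2 : (k:ℝ) ≤ 1 / ε := Nat.floor_le (by positivity)
  have hk3 : 1 < ε * ((k:ℝ) + 1) := by
    rw [div_lt_iff₀ hε] at hk1; linarith
  set d : ℝ := 1 / (ε * ((k:ℝ) + 1) * n) with hd
  have hd0 : 0 < d := by positivity
  have hsq : Real.sqrt d ^ 2 = d := Real.sq_sqrt hd0.le
  obtain ⟨U, hU, S, hS, htr, hI⟩ := aux_main n hn (fun i => Real.sqrt d • v i) (by
    have h1 : ∀ i ∈ Finset.univ, ‖Real.sqrt d • v i‖ ^ 2 ≤ d := by
      intro i _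
      rw [norm_smul, mul_pow, Real.norm_eq_abs, sq_abs, hsq]
      have : ‖v i‖ ^ 2 ≤ 1 := pow_le_one₀ (norm_nonneg _) (hv i)
      nlinarith
    refine (Finset.sum_le_sum h1).trans_lt ?_
    rw [Finset.sum_const, Finset.card_univ, Fintype.card_fin, nsmul_eq_mul, hd,
      mul_one_div, div_lt_one (by positivity)]
    nlinarith) k
  refine ⟨U, le_trans (by exact_mod_cast hU) hk2, ?_⟩
  set w : Fin n → H := fun i => Q U (v i) with hw
  have hin : ∀ i j, (⟪v i, w j⟫ : ℝ) = ⟪w i, w j⟫ := by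
    intro i j
    rw [hw]
    simp only
    rw [hQsa, hQidem]
  have hb : ∀ j, d * (k + 1) * ∑ i, (⟪w i, w j⟫ : ℝ) ^ 2 ≤ ‖w j‖ ^ 2 := by
    intro j
    have h := hI (w j) (by
      intro i hi
      rw [real_inner_smul_left, real_inner_comm, hw]
      simp [hQorth U i hi])
    have ea : (fun i => (⟪Real.sqrt d • v i, w j⟫ : ℝ)) =
        fun i => Real.sqrt d * ⟪w i, w j⟫ := by
      funext i
      rw [real_inner_smul_left, hin]
    rw [ea] at h
    have h1 := h (fun i => Real.sqrt d * ⟪w i, w j⟫)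
    have h2 := aux_quad_le_trace S hS (fun i => Real.sqrt d * ⟪w i, w j⟫)
    have e : (fun i => Real.sqrt d * (⟪w i, w j⟫ : ℝ)) ⬝ᵥ
        (fun i => Real.sqrt d * (⟪w i, w j⟫ : ℝ)) = d * ∑ i, (⟪w i, w j⟫ : ℝ) ^ 2 := by
      rw [dotProduct, Finset.mul_sum]
      refine Finset.sum_congr rfl fun i _ => ?_
      rw [← hsq, Real.sqrt_sq (Real.sqrt_nonneg _)]; ring
    rw [e] at h1 h2
    have h3 : 0 ≤ d * ∑ i, (⟪w i, w j⟫ : ℝ) ^ 2 := by positivity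
    nlinarith
  have hb2 : ∀ j, ∑ i, (⟪w i, w j⟫ : ℝ) ^ 2 / ‖w j‖ ^ 2 ≤ ε * n := by
    intro j
    rw [← Finset.sum_div]
    apply div_le_of_le_mul₀ (by positivity) (by positivity)
    have h := hb j
    have e : d * (k + 1) = 1 / (ε * n) := by rw [hd]; field_simp
    rw [e, one_div_mul_eq_div, div_le_iff₀ (by positivity)] at h
    linarith
  have hterm : ∀ i j, (⟪w i, w j⟫ : ℝ) ^ 2 / (‖w i‖ * ‖w j‖) ≤
      (1 / 2) * ((⟪w i, w j⟫ : ℝ) ^ 2 / ‖w j‖ ^ 2) +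
      (1 / 2) * ((⟪w j, w i⟫ : ℝ) ^ 2 / ‖w i‖ ^ 2) := by
    intro i j
    rw [real_inner_comm (w i) (w j)]
    have h := mul_nonneg (sq_nonneg (⟪w i, w j⟫ : ℝ)) (sq_nonneg (‖w i‖⁻¹ - ‖w j‖⁻¹))
    simp only [div_eq_mul_inv, mul_inv, ← inv_pow, real_inner_comm (w i) (w j)] at h ⊢
    nlinarith
  have hsum : ∑ i, ∑ j, (⟪w i, w j⟫ : ℝ) ^ 2 / (‖w i‖ * ‖w j‖) ≤ ε * n * n := by
    have hA : ∑ j, ∑ i, (⟪w i, w j⟫ : ℝ) ^ 2 / ‖w j‖ ^ 2 ≤ ε * n * n := by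
      refine (Finset.sum_le_sum fun j _ => hb2 j).trans ?_
      simp [mul_comm]
    refine (Finset.sum_le_sum fun i _ => Finset.sum_le_sum fun j _ => hterm i j).trans ?_
    simp only [Finset.sum_add_distrib, ← Finset.mul_sum]
    rw [Finset.sum_comm]
    linarith
  change 1 / (n:ℝ) ^ 2 * ∑ i, ∑ j, (⟪w i, w j⟫ : ℝ) ^ 2 / (‖w i‖ * ‖w j‖) ≤ ε
  rw [one_div_mul_eq_div, div_le_iff₀ (by positivity)]
  linarith

end
end
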